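/- arXiv:1402.2520 — 2 statements merged into one kernel-verified Lean document; each statement's English description precedes it below -/
import Mathlib

section
/- Let B_n denote the classical Bernstein operator on C[0,1], B_n(f; x) = Σ_{k=0}^{n} C(n,k) x^k (1-x)^{n-k} f(k/n). For every positive integers n and r, every f ∈ C[0,1] and every x ∈ [0,1], the r-th iterate satisfies |B_n^r(f; x) - B_1(f; x)| ≤ (9/4)·ω₂(f, √(x(1-x)·(1 - 1/n)^r)), where B_1(f; x) = (1-x)f(0) + x f(1). -/
open Set Finset

noncomputable section

/-- Second order modulus of smoothness of `f` on `[a,b]`. -/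
def omega2 (a b : ℝ) (f : ℝ → ℝ) (δ : ℝ) : ℝ :=
  sSup {v | ∃ x h : ℝ, x - h ∈ Set.Icc a b ∧ x + h ∈ Set.Icc a b ∧ |h| ≤ δ ∧
    v = |f (x - h) - 2 * f x + f (x + h)|}

/-- The classical Bernstein operator of degree `n` on `[0,1]`. -/
def bern (n : ℕ) (f : ℝ → ℝ) : ℝ → ℝ := fun x =>
  ∑ k ∈ Finset.range (n + 1), (n.choose k : ℝ) * x ^ k * (1 - x) ^ (n - k) * f ((k : ℝ) / (n : ℝ))

theorem bern_mono {n : ℕ} {f g : ℝ → ℝ} (h : ∀ y ∈ Set.Icc (0 : ℝ) 1, f y ≤ g y) :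
    ∀ y ∈ Set.Icc (0 : ℝ) 1, bern n f y ≤ bern n g y := by
  intro y hy
  have h1 : 0 ≤ 1 - y := by linarith [hy.2]
  refine Finset.sum_le_sum fun k hk => ?_
  have hk' : (k : ℝ) ≤ n := by
    exact_mod_cast Nat.lt_succ_iff.mp (Finset.mem_range.mp hk)
  have hy0 : 0 ≤ y := hy.1
  refine mul_le_mul_of_nonneg_left (h _ ⟨by positivity, ?_⟩) (by positivity)
  exact div_le_one_of_le₀ hk' (by positivity)

theorem bern_iterate_mono {n : ℕ} (r : ℕ) {f g : ℝ → ℝ}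
    (h : ∀ y ∈ Set.Icc (0 : ℝ) 1, f y ≤ g y) :
    ∀ y ∈ Set.Icc (0 : ℝ) 1, (bern n)^[r] f y ≤ (bern n)^[r] g y := by
  induction r generalizing f g with
  | zero => exact h
  | succ r ih =>
    simp only [Function.iterate_succ_apply]
    exact ih (bern_mono h)

theorem bern_quadratic {n : ℕ} (hn : 0 < n) (a b c : ℝ) :
    bern n (fun y => a + b * y + c * (y * (1 - y))) =
      fun y => a + b * y + c * (1 - 1 / (n : ℝ)) * (y * (1 - y)) := by
  have hn' : (n : ℝ) ≠ 0 := by positivity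
  funext x
  have e0 := congrArg (Polynomial.eval x) (bernsteinPolynomial.sum ℝ n)
  have e1 := congrArg (Polynomial.eval x) (bernsteinPolynomial.sum_smul ℝ n)
  have e2 := congrArg (Polynomial.eval x) (bernsteinPolynomial.sum_mul_smul ℝ n)
  simp only [Polynomial.eval_finsetSum, bernsteinPolynomial,
    Polynomial.eval_mul, Polynomial.eval_pow, Polynomial.eval_sub, Polynomial.eval_one,
    Polynomial.eval_X, Polynomial.eval_natCast, nsmul_eq_mul] at e0 e1 e2
  have cast_pred : ∀ k : ℕ, ((k * (k - 1) : ℕ) : ℝ) = (k : ℝ) * (k - 1) := by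
    rintro (_ | k) <;> simp
  simp only [cast_pred] at e2
  have key : ∀ s₀ s₁ s₂ : ℝ, ∑ k ∈ Finset.range (n + 1), (n.choose k : ℝ) * x ^ k * (1 - x) ^ (n - k) = s₀ →
      ∑ k ∈ Finset.range (n + 1), (k : ℝ) * (n.choose k * x ^ k * (1 - x) ^ (n - k)) = s₁ →
      ∑ k ∈ Finset.range (n + 1),
        (k : ℝ) * (k - 1) * (n.choose k * x ^ k * (1 - x) ^ (n - k)) = s₂ →
      bern n (fun y => a + b * y + c * (y * (1 - y))) x =
        a * s₀ + (b / n + c / n - c / n ^ 2) * s₁ - c / n ^ 2 * s₂ := by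
    rintro _ _ _ rfl rfl rfl
    rw [Finset.mul_sum, Finset.mul_sum, Finset.mul_sum,
      ← Finset.sum_add_distrib, ← Finset.sum_sub_distrib]
    refine Finset.sum_congr rfl fun k _ => ?_
    field_simp
    ring
  rw [key _ _ _ e0 e1 e2]
  field_simp
  ring

theorem bern_iterate_quadratic {n : ℕ} (hn : 0 < n) (r : ℕ) (a b c : ℝ) :
    (bern n)^[r] (fun y => a + b * y + c * (y * (1 - y))) =
      fun y => a + b * y + c * (1 - 1 / (n : ℝ)) ^ r * (y * (1 - y)) := by
  induction r generalizing c with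
  | zero => simp
  | succ r ih =>
    rw [Function.iterate_succ_apply, bern_quadratic hn, ih]
    funext y
    ring

theorem bern_zero {n : ℕ} (f : ℝ → ℝ) : bern n f 0 = f 0 := by
  unfold bern
  rw [Finset.sum_eq_single 0]
  · simp
  · intro k _ hk
    simp [hk]
  · simp

theorem bern_one {n : ℕ} (hn : 0 < n) (f : ℝ → ℝ) : bern n f 1 = f 1 := by
  unfold bern
  rw [Finset.sum_eq_single n]
  · have : (n : ℝ) ≠ 0 := by positivity
    simp [this]
  · intro k hk hkn
    have : n - k ≠ 0 := by
      have := Finset.mem_range.mp hk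
      omega
    simp [this]
  · simp

theorem bern_degree_one (f : ℝ → ℝ) : bern 1 f = fun y => (1 - y) * f 0 + y * f 1 := by
  funext y
  simp [bern, Finset.sum_range_succ]

theorem bern_iterate_zero {n : ℕ} (r : ℕ) (f : ℝ → ℝ) : (bern n)^[r] f 0 = f 0 := by
  induction r generalizing f with
  | zero => rfl
  | succ r ih => rw [Function.iterate_succ_apply, ih, bern_zero]

theorem bern_iterate_one {n : ℕ} (hn : 0 < n) (r : ℕ) (f : ℝ → ℝ) :
    (bern n)^[r] f 1 = f 1 := by
  induction r generalizing f with
  | zero => rfl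
  | succ r ih => rw [Function.iterate_succ_apply, ih, bern_one hn]

theorem bern_one_iterate {r : ℕ} (hr : 0 < r) (f : ℝ → ℝ) (x : ℝ) :
    (bern 1)^[r] f x = (1 - x) * f 0 + x * f 1 := by
  obtain ⟨r, rfl⟩ := Nat.exists_eq_succ_of_ne_zero hr.ne'
  rw [Function.iterate_succ_apply, bern_degree_one]
  have h : (fun y : ℝ => (1 - y) * f 0 + y * f 1) =
      fun y => f 0 + (f 1 - f 0) * y + 0 * (y * (1 - y)) := by
    funext y
    ring
  rw [h, bern_iterate_quadratic Nat.one_pos]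
  ring

theorem omega2_nonneg (a b : ℝ) (f : ℝ → ℝ) (δ : ℝ) : 0 ≤ omega2 a b f δ := by
  refine Real.sSup_nonneg ?_
  rintro _ ⟨x, h, -, -, -, rfl⟩
  exact abs_nonneg _

theorem abs_second_difference_le_omega2 {a b : ℝ} {f : ℝ → ℝ}
    (hf : ContinuousOn f (Set.Icc a b)) {δ x h : ℝ} (h₁ : x - h ∈ Set.Icc a b)
    (h₂ : x + h ∈ Set.Icc a b) (hh : |h| ≤ δ) :
    |f (x - h) - 2 * f x + f (x + h)| ≤ omega2 a b f δ := by
  obtain ⟨C, hC⟩ := isCompact_Icc.exists_bound_of_continuousOn hf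
  refine le_csSup ⟨4 * C, ?_⟩ ⟨x, h, h₁, h₂, hh, rfl⟩
  rintro _ ⟨y, t, hy₁, hy₂, -, rfl⟩
  have hy : y ∈ Set.Icc a b := ⟨by linarith [hy₁.1, hy₂.1], by linarith [hy₁.2, hy₂.2]⟩
  have b₁ := abs_le.mp (hC _ hy₁)
  have b₂ := abs_le.mp (hC _ hy₂)
  have b₃ := abs_le.mp (hC _ hy)
  exact abs_le.mpr ⟨by linarith [b₁.1, b₂.1, b₃.2], by linarith [b₁.2, b₂.2, b₃.1]⟩

/-- If the second differences of `f` with step at most `h` exceed `-W`, then `f` lies below its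
chord plus an explicit quadratic: the difference cannot be maximal at distance at least `h` from
the endpoints, and near an endpoint it is controlled by one second difference. -/
theorem le_chord_add_quadratic {f : ℝ → ℝ} (hf : ContinuousOn f (Set.Icc 0 1)) {h W : ℝ}
    (h0 : 0 < h) (h1 : h ≤ 1 / 2) (hW : 0 < W)
    (hd : ∀ y t, y - t ∈ Set.Icc (0 : ℝ) 1 → y + t ∈ Set.Icc (0 : ℝ) 1 → |t| ≤ h →
      -W < f (y - t) - 2 * f y + f (y + t)) :
    ∀ y ∈ Set.Icc (0 : ℝ) 1,
      f y ≤ (f 0 + W) + (f 1 - f 0) * y + W / (2 * h ^ 2) * (y * (1 - y)) := by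
  set A := W / (2 * h ^ 2) with hA
  have hA0 : 0 < A := by positivity
  have hAh : 2 * A * h ^ 2 = W := by
    rw [hA]
    field_simp
  set φ : ℝ → ℝ := fun y => f y - (f 0 + (f 1 - f 0) * y + A * (y * (1 - y))) with hφ
  have hφd : ∀ y t, φ (y - t) - 2 * φ y + φ (y + t) =
      f (y - t) - 2 * f y + f (y + t) + 2 * A * t ^ 2 := by
    intro y t
    simp only [hφ]
    ring
  have hφ0 : φ 0 = 0 := by simp [hφ]
  have hφ1 : φ 1 = 0 := by simp [hφ]
  have hφc : ContinuousOn φ (Set.Icc 0 1) := hf.sub (by fun_prop)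
  obtain ⟨m, hm, hmax⟩ := isCompact_Icc.exists_isMaxOn (nonempty_Icc.mpr zero_le_one) hφc
  have hmax' : ∀ y ∈ Set.Icc (0 : ℝ) 1, φ y ≤ φ m := fun y hy => hmax hy
  obtain ⟨m0, m1⟩ := hm
  have hmW : φ m ≤ W := by
    rcases lt_or_ge m h with hmh | hmh
    · have i₁ : m - m ∈ Set.Icc (0 : ℝ) 1 := by simp
      have i₂ : m + m ∈ Set.Icc (0 : ℝ) 1 := ⟨by linarith, by linarith⟩
      have d := hd m m i₁ i₂ (by rw [abs_of_nonneg m0]; exact hmh.le)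
      have e := hφd m m
      rw [sub_self, hφ0] at e
      rw [sub_self] at d
      have := hmax' _ i₂
      nlinarith [mul_nonneg hA0.le (sq_nonneg m)]
    rcases lt_or_ge (1 - h) m with hmh' | hmh'
    · have s : m + (1 - m) = 1 := by ring
      have i₁ : m - (1 - m) ∈ Set.Icc (0 : ℝ) 1 := ⟨by linarith, by linarith⟩
      have i₂ : m + (1 - m) ∈ Set.Icc (0 : ℝ) 1 := by simp
      have d := hd m (1 - m) i₁ i₂ (by rw [abs_of_nonneg (by linarith)]; linarith)
      have e := hφd m (1 - m)
      rw [s, hφ1] at e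
      rw [s] at d
      have := hmax' _ i₁
      nlinarith [mul_nonneg hA0.le (sq_nonneg (1 - m))]
    · have i₁ : m - h ∈ Set.Icc (0 : ℝ) 1 := ⟨by linarith, by linarith⟩
      have i₂ : m + h ∈ Set.Icc (0 : ℝ) 1 := ⟨by linarith, by linarith⟩
      have d := hd m h i₁ i₂ (by rw [abs_of_pos h0])
      have e := hφd m h
      linarith [hmax' _ i₁, hmax' _ i₂]
  intro y hy
  have := (hmax' y hy).trans hmW
  simp only [hφ] at this
  linarith

/-- For a positive step the constant `9 / 4` improves to `3 / 2`. -/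
theorem bern_iterate_sub_chord_le {n r : ℕ} (hn : 0 < n) {f : ℝ → ℝ}
    (hf : ContinuousOn f (Set.Icc 0 1)) {x : ℝ} (hx : x ∈ Set.Icc (0 : ℝ) 1) {h : ℝ}
    (h0 : 0 < h) (h1 : h ≤ 1 / 2) (hh : h ^ 2 = x * (1 - x) * (1 - 1 / (n : ℝ)) ^ r) :
    |(bern n)^[r] f x - ((1 - x) * f 0 + x * f 1)| ≤ 3 / 2 * omega2 0 1 f h := by
  have main : ∀ W, omega2 0 1 f h < W →
      |(bern n)^[r] f x - ((1 - x) * f 0 + x * f 1)| ≤ 3 / 2 * W := by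
    intro W hW
    have hW0 : 0 < W := (omega2_nonneg _ _ _ _).trans_lt hW
    have hq : W / (2 * h ^ 2) * (1 - 1 / (n : ℝ)) ^ r * (x * (1 - x)) = W / 2 := by
      have : W / (2 * h ^ 2) * h ^ 2 = W / 2 := by field_simp
      rw [← this, hh]
      ring
    have upper := le_chord_add_quadratic hf h0 h1 hW0 fun y t hy₁ hy₂ ht =>
      neg_lt_of_abs_lt ((abs_second_difference_le_omega2 hf hy₁ hy₂ ht).trans_lt hW)
    have lower := le_chord_add_quadratic hf.neg h0 h1 hW0 fun y t hy₁ hy₂ ht => by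
      have := lt_of_abs_lt ((abs_second_difference_le_omega2 hf hy₁ hy₂ ht).trans_lt hW)
      simp only [Pi.neg_apply]
      linarith
    have lower' : ∀ y ∈ Set.Icc (0 : ℝ) 1,
        (f 0 - W) + (f 1 - f 0) * y + -(W / (2 * h ^ 2)) * (y * (1 - y)) ≤ f y := by
      intro y hy
      have := lower y hy
      simp only [Pi.neg_apply] at this
      linarith
    have u := bern_iterate_mono (n := n) r upper x hx
    have l := bern_iterate_mono (n := n) r lower' x hx
    rw [bern_iterate_quadratic hn] at u l
    exact abs_le.mpr ⟨by linarith, by linarith⟩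
  by_contra! hlt
  linarith [main (2 / 3 * |(bern n)^[r] f x - ((1 - x) * f 0 + x * f 1)| / 2 +
    omega2 0 1 f h / 2) (by linarith)]

theorem bernstein_iterates
    (n r : ℕ) (hn : 0 < n) (hr : 0 < r)
    (f : ℝ → ℝ) (hf : ContinuousOn f (Set.Icc 0 1))
    (x : ℝ) (hx : x ∈ Set.Icc (0 : ℝ) 1) :
    |(bern n)^[r] f x - ((1 - x) * f 0 + x * f 1)| ≤
      9 / 4 * omega2 0 1 f (Real.sqrt (x * (1 - x) * (1 - 1 / (n : ℝ)) ^ r)) := by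
  have hω := omega2_nonneg 0 1 f (Real.sqrt (x * (1 - x) * (1 - 1 / (n : ℝ)) ^ r))
  have of_eq : (bern n)^[r] f x = (1 - x) * f 0 + x * f 1 →
      |(bern n)^[r] f x - ((1 - x) * f 0 + x * f 1)| ≤
        9 / 4 * omega2 0 1 f (Real.sqrt (x * (1 - x) * (1 - 1 / (n : ℝ)) ^ r)) := by
    intro h
    rw [h, sub_self, abs_zero]
    positivity
  obtain ⟨hx0, hx1⟩ := hx
  rcases hx0.eq_or_lt with rfl | hx0'
  · exact of_eq (by rw [bern_iterate_zero]; ring)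
  rcases hx1.eq_or_lt with rfl | hx1'
  · exact of_eq (by rw [bern_iterate_one hn]; ring)
  rcases Nat.eq_or_lt_of_le hn with rfl | hn1
  · exact of_eq (bern_one_iterate hr f x)
  have hn1' : (1 : ℝ) < n := by exact_mod_cast hn1
  have hq0 : 0 < 1 - 1 / (n : ℝ) := by
    rw [sub_pos, div_lt_one (by linarith)]
    exact hn1'
  have hq1 : (1 - 1 / (n : ℝ)) ^ r ≤ 1 := pow_le_one₀ hq0.le (sub_le_self _ (by positivity))
  have hx2 : 0 < x * (1 - x) := mul_pos hx0' (sub_pos.mpr hx1')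
  have hpos : 0 < x * (1 - x) * (1 - 1 / (n : ℝ)) ^ r := by positivity
  have hle : Real.sqrt (x * (1 - x) * (1 - 1 / (n : ℝ)) ^ r) ≤ 1 / 2 := by
    refine Real.sqrt_le_iff.mpr ⟨by norm_num, ?_⟩
    have := mul_le_of_le_one_right hx2.le hq1
    nlinarith [sq_nonneg (x - 1 / 2)]
  have := bern_iterate_sub_chord_le hn hf ⟨hx0, hx1⟩ (Real.sqrt_pos.mpr hpos) hle
    (Real.sq_sqrt hpos.le)
  linarith
end
end

section
/- Let n, m, r be positive integers and 1 ≤ k ≤ m. For every f ∈ C[0,1] and every x ∈ [(k-1)/m, k/m], the r-th iterate of the composite Bernstein operator satisfies |(B̄_{n,m})^r(f; x) - S_{Δ_m}(f; x)| ≤ (9/4)·ω₂(f, √((x - (k-1)/m)·(k/m - x)·(1 - 1/n)^r)). -/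
open Set Finset

noncomputable section

/-- The Bernstein polynomial of degree `n` associated to `f` on the
subinterval `[(k-1)/m, k/m]`. -/
def bernsteinPiece (n m k : ℕ) (f : ℝ → ℝ) (x : ℝ) : ℝ :=
  (m : ℝ) ^ n * ∑ i ∈ Finset.range (n + 1),
    (n.choose i : ℝ) * (x - ((k : ℝ) - 1) / (m : ℝ)) ^ i * ((k : ℝ) / (m : ℝ) - x) ^ (n - i) *
      f (((k : ℝ) * n - n + i) / ((m : ℝ) * n))

/-- The index `k` (with `1 ≤ k ≤ m`) such that `x` belongs to the piece `[(k-1)/m, k/m]`. -/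
def pieceIdx (m : ℕ) (x : ℝ) : ℕ := min m (⌊(m : ℝ) * x⌋.toNat + 1)

/-- The composite Bernstein operator `B̄_{n,m}`. -/
def compBernstein (n m : ℕ) (f : ℝ → ℝ) : ℝ → ℝ := fun x =>
  bernsteinPiece n m (pieceIdx m x) f x

/-- The piecewise linear interpolation operator at the nodes `k/m`, `k = 0, …, m`. -/
def pwLinear (m : ℕ) (f : ℝ → ℝ) : ℝ → ℝ := fun x =>
  (m : ℝ) * (((pieceIdx m x : ℝ) / (m : ℝ) - x) * f (((pieceIdx m x : ℝ) - 1) / (m : ℝ)) +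
    (x - ((pieceIdx m x : ℝ) - 1) / (m : ℝ)) * f ((pieceIdx m x : ℝ) / (m : ℝ)))

open MeasureTheory intervalIntegral

theorem exists_affine_of_chord_extremal {f : ℝ → ℝ} {a b u c v E ω : ℝ}
    (hu : a ≤ u) (huc : u < c) (hcv : c < v) (hv : v ≤ b)
    (hext : f c * (v - u) - f u * (v - c) - f v * (c - u) = -(2 * E) * (v - u))
    (hchord : ∀ x y z, a ≤ x → x ≤ y → y ≤ z → z ≤ b →
      |f y * (z - x) - f x * (z - y) - f z * (y - x)| ≤ 2 * E * (z - x))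
    (hω : ∀ x t, a ≤ x - |t| → x + |t| ≤ b → |f (x - t) - 2 * f x + f (x + t)| ≤ ω) :
    ∃ p q : ℝ, ∀ x ∈ Set.Icc a b, |f x - (p * x + q)| ≤ ω / 2 := by
  have huv : 0 < v - u := by linarith
  obtain ⟨s, hs⟩ : ∃ s, s * (v - u) = f v - f u := ⟨(f v - f u) / (v - u), by field_simp⟩
  set g : ℝ → ℝ := fun x => f x - (f u + s * (x - u)) with hg
  have hgu : g u = 0 := by simp [hg]
  have hgv : g v = 0 := by simp [hg, hs]
  have hgc : g c = -(2 * E) := by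
    apply mul_right_cancel₀ huv.ne'
    simp only [hg]
    linear_combination hext - (c - u) * hs
  have hgchord : ∀ x y z, a ≤ x → x ≤ y → y ≤ z → z ≤ b →
      |g y * (z - x) - g x * (z - y) - g z * (y - x)| ≤ 2 * E * (z - x) := by
    intro x y z h1 h2 h3 h4
    convert hchord x y z h1 h2 h3 h4 using 2
    simp only [hg]; ring
  have hgω : ∀ x t, a ≤ x - |t| → x + |t| ≤ b → |g (x - t) - 2 * g x + g (x + t)| ≤ ω := by
    intro x t h1 h2
    convert hω x t h1 h2 using 2
    simp only [hg]; ring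
  have hup : ∀ x ∈ Set.Icc a b, g x ≤ 0 := by
    intro x hx
    rcases le_total x c with h | h
    · have := (abs_le.1 (hgchord x c v hx.1 h hcv.le hv)).1
      rw [hgc, hgv] at this
      by_contra hpos
      push Not at hpos
      nlinarith [mul_pos hpos (sub_pos.2 hcv)]
    · have := (abs_le.1 (hgchord u c x hu huc.le h hx.2)).1
      rw [hgc, hgu] at this
      by_contra hpos
      push Not at hpos
      nlinarith [mul_pos hpos (sub_pos.2 huc)]
  have hlow : ∀ x ∈ Set.Icc a b, -(2 * E) ≤ g x := by
    intro x hx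
    by_contra hneg
    push Not at hneg
    rcases lt_or_ge x u with h | h
    · have := (abs_le.1 (hgchord x u c hx.1 h.le huc.le (by linarith))).2
      rw [hgc, hgu] at this
      nlinarith [mul_pos (sub_pos.2 hneg) (sub_pos.2 huc)]
    · rcases lt_or_ge v x with h' | h'
      · have := (abs_le.1 (hgchord c v x (by linarith) hcv.le h'.le hx.2)).2
        rw [hgc, hgv] at this
        nlinarith [mul_pos (sub_pos.2 hneg) (sub_pos.2 hcv)]
      · have := (abs_le.1 (hgchord u x v hu h h' hv)).1
        rw [hgu, hgv] at this
        nlinarith [mul_pos (sub_pos.2 hneg) huv]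
  have hE : 2 * E ≤ ω := by
    rcases le_total (c - u) (v - c) with h | h
    · have hab : |c - u| = c - u := abs_of_nonneg (by linarith)
      have h1 := (abs_le.1 (hgω c (c - u) (by rw [hab]; linarith) (by rw [hab]; linarith))).2
      have h2 := hlow (c + (c - u)) ⟨by linarith, by linarith⟩
      rw [show c - (c - u) = u by ring, hgu, hgc] at h1
      linarith
    · have hab : |v - c| = v - c := abs_of_nonneg (by linarith)
      have h1 := (abs_le.1 (hgω c (v - c) (by rw [hab]; linarith) (by rw [hab]; linarith))).2
      have h2 := hlow (c - (v - c)) ⟨by linarith, by linarith⟩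
      rw [show c + (v - c) = v by ring, hgv, hgc] at h1
      linarith
  refine ⟨s, f u - s * u - E, fun x hx => ?_⟩
  have h1 := hup x hx
  have h2 := hlow x hx
  simp only [hg] at h1 h2
  rw [abs_le]
  constructor <;> linarith

theorem exists_affine_abs_sub_le {f : ℝ → ℝ} (hf : Continuous f) {a b ω : ℝ} (hab : a < b)
    (hω : ∀ x t, a ≤ x - |t| → x + |t| ≤ b → |f (x - t) - 2 * f x + f (x + t)| ≤ ω) :
    ∃ p q : ℝ, ∀ x ∈ Set.Icc a b, |f x - (p * x + q)| ≤ ω / 2 := by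
  set D : ℝ × ℝ × ℝ → ℝ := fun w =>
    f (w.2.2 * w.1 + (1 - w.2.2) * w.2.1) - w.2.2 * f w.1 - (1 - w.2.2) * f w.2.1 with hD
  have hDc : Continuous D := by fun_prop
  obtain ⟨⟨u, v, l⟩, ⟨hu, hv, hl⟩, hmax⟩ :=
    (isCompact_Icc.prod (isCompact_Icc.prod isCompact_Icc)).exists_isMaxOn
      (s := Set.Icc a b ×ˢ Set.Icc a b ×ˢ Set.Icc (0 : ℝ) 1) (f := fun w => |D w|)
      ⟨(a, a, 0), by simp [hab.le]⟩ hDc.abs.continuousOn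
  simp only at hu hv hl
  obtain ⟨E, hE⟩ : ∃ E, 2 * E = |D (u, v, l)| := ⟨|D (u, v, l)| / 2, by ring⟩
  have hω0 : 0 ≤ ω := by
    have := hω a 0 (by simp) (by simp [hab.le])
    exact (abs_nonneg _).trans this
  have hchord : ∀ x y z, a ≤ x → x ≤ y → y ≤ z → z ≤ b →
      |f y * (z - x) - f x * (z - y) - f z * (y - x)| ≤ 2 * E * (z - x) := by
    intro x y z h1 h2 h3 h4
    rcases (h2.trans h3).eq_or_lt with h | h
    · have e1 : y = x := by linarith
      subst e1; subst h; simp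
    · have hzx : 0 < z - x := by linarith
      have hmem : (x, z, (z - y) / (z - x)) ∈ Set.Icc a b ×ˢ Set.Icc a b ×ˢ Set.Icc (0 : ℝ) 1 := by
        refine ⟨⟨h1, by linarith⟩, ⟨by linarith, h4⟩, by
          apply div_nonneg <;> linarith, ?_⟩
        simp only
        rw [div_le_one hzx]; linarith
      have h5 : |D (x, z, (z - y) / (z - x))| ≤ |D (u, v, l)| := hmax hmem
      have h6 : f y * (z - x) - f x * (z - y) - f z * (y - x)
          = D (x, z, (z - y) / (z - x)) * (z - x) := by
        have : (z - y) / (z - x) * x + (1 - (z - y) / (z - x)) * z = y := by field_simp; ring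
        simp only [hD, this]
        field_simp; ring
      rw [h6, abs_mul, abs_of_pos hzx, hE]
      gcongr
  rcases (abs_nonneg (D (u, v, l))).eq_or_lt with h0 | h0
  · have hba : b - a ≠ 0 := by linarith
    refine ⟨(f b - f a) / (b - a), f a - (f b - f a) / (b - a) * a, fun x hx => ?_⟩
    have := hchord a x b le_rfl hx.1 hx.2 le_rfl
    rw [hE, ← h0, zero_mul] at this
    have h7 := abs_eq_zero.1 (le_antisymm this (abs_nonneg _))
    have : f x - ((f b - f a) / (b - a) * x + (f a - (f b - f a) / (b - a) * a)) = 0 := by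
      field_simp
      linear_combination h7
    rw [this, abs_zero]; linarith
  · obtain ⟨u', c, v', hu', huc, hcv, hv', hext⟩ : ∃ u' c v', a ≤ u' ∧ u' < c ∧ c < v' ∧ v' ≤ b ∧
        |f c * (v' - u') - f u' * (v' - c) - f v' * (c - u')| = 2 * E * (v' - u') := by
      have hl0 : l ≠ 0 := by rintro rfl; simp [hD] at h0
      have hl1 : l ≠ 1 := by rintro rfl; simp [hD] at h0
      have huv : u ≠ v := by
        rintro rfl
        have : D (u, u, l) = 0 := by
          simp only [hD]; rw [show l * u + (1 - l) * u = u by ring]; ring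
        simp [this] at h0
      have hl0' : 0 < l := lt_of_le_of_ne hl.1 hl0.symm
      have hl1' : l < 1 := lt_of_le_of_ne hl.2 hl1
      rcases lt_or_gt_of_ne huv with h | h
      · refine ⟨u, l * u + (1 - l) * v, v, hu.1, by nlinarith, by nlinarith, hv.2, ?_⟩
        rw [hE, ← abs_of_pos (sub_pos.2 h), ← abs_mul]
        rw [abs_of_pos (sub_pos.2 h)]
        congr 1
        simp only [hD]; ring
      · refine ⟨v, l * u + (1 - l) * v, u, hv.1, by nlinarith, by nlinarith, hu.2, ?_⟩
        rw [hE, ← abs_of_pos (sub_pos.2 h), ← abs_mul]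
        rw [abs_of_pos (sub_pos.2 h)]
        congr 1
        simp only [hD]; ring
    have hE0 : 0 ≤ 2 * E * (v' - u') := hext ▸ abs_nonneg _
    rcases eq_or_eq_neg_of_abs_eq hext with h | h
    · obtain ⟨p, q, hpq⟩ := exists_affine_of_chord_extremal (f := fun x => -f x) (E := E) (ω := ω)
        hu' huc hcv hv' (by linear_combination -h)
        (fun x y z h1 h2 h3 h4 => by
          rw [← abs_neg]; convert hchord x y z h1 h2 h3 h4 using 2; ring)
        (fun x t h1 h2 => by
          rw [← abs_neg]; convert hω x t h1 h2 using 2; ring)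
      refine ⟨-p, -q, fun x hx => ?_⟩
      rw [← abs_neg]; convert hpq x hx using 2; ring
    · exact exists_affine_of_chord_extremal hu' huc hcv hv' (by linear_combination h) hchord hω

theorem intervalIntegrable_ite_ite {P f Q : ℝ → ℝ} (hP : Continuous P) (hf : Continuous f)
    (hQ : Continuous Q) (c d a b : ℝ) :
    IntervalIntegrable (fun x => if x < c then P x else if x ≤ d then f x else Q x) volume a b := by
  rw [intervalIntegrable_iff]
  have key : ∀ g : ℝ → ℝ, Continuous g → IntegrableOn g (uIoc a b) := fun g hg =>
    intervalIntegrable_iff.1 (hg.intervalIntegrable a b)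
  exact Integrable.piecewise (s := Set.Iio c) measurableSet_Iio (key P hP).integrableOn
    (Integrable.piecewise (s := Set.Iic d) measurableSet_Iic (key f hf).integrableOn
      (key Q hQ).integrableOn).integrableOn

theorem exists_steklov_mean {F : ℝ → ℝ} (hF : ∀ a b, IntervalIntegrable F volume a b)
    {h M : ℝ} (hh : 0 < h)
    (hM : ∀ x ∈ Set.Icc (0 : ℝ) 1, ∀ t ∈ Set.Icc 0 h, |F (x - t) - 2 * F x + F (x + t)| ≤ M) :
    ∃ g : ℝ → ℝ, (∀ x ∈ Set.Icc (0 : ℝ) 1, |F x - g x| ≤ M / 2) ∧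
      ConvexOn ℝ (Set.Icc 0 1) (fun x => M / (2 * h ^ 2) * x ^ 2 + g x) ∧
      ConvexOn ℝ (Set.Icc 0 1) (fun x => M / (2 * h ^ 2) * x ^ 2 - g x) := by
  set G : ℝ → ℝ := fun x => ∫ s in (0 : ℝ)..x, F s with hG
  have hGc : Continuous G := continuous_primitive hF 0
  set H : ℝ → ℝ := fun x => ∫ s in (0 : ℝ)..x, G s with hH
  have hHd : ∀ x, HasDerivAt H (G x) x := fun x =>
    (hGc.integral_hasStrictDerivAt 0 x).hasDerivAt
  have hGsub : ∀ x y, G y - G x = ∫ s in x..y, F s := fun x y =>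
    integral_interval_sub_left (hF 0 y) (hF 0 x)
  have hFadd : ∀ c a b, IntervalIntegrable (fun s => F (s + c)) volume a b := fun c a b => by
    simpa using (hF (a + c) (b + c)).comp_add_right c
  have hFsub : ∀ c a b, IntervalIntegrable (fun s => F (s - c)) volume a b := fun c a b => by
    simpa using (hF (a - c) (b - c)).comp_sub_right c
  have hFadd' : ∀ c a b, IntervalIntegrable (fun s => F (c + s)) volume a b := fun c a b => by
    simpa using (hF (c + a) (c + b)).comp_add_left c
  have hFsub' : ∀ c a b, IntervalIntegrable (fun s => F (c - s)) volume a b := fun c a b => by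
    simpa using (hF (c - a) (c - b)).comp_sub_left c
  set W : ℝ → ℝ := fun x => G (x + h) - 2 * G x + G (x - h) with hW
  set Z : ℝ → ℝ := fun x => (H (x + h) - 2 * H x + H (x - h)) / h ^ 2 with hZ
  have hZd : ∀ x, HasDerivAt Z (W x / h ^ 2) x := fun x =>
    ((((hHd (x + h)).comp_add_const x h).sub ((hHd x).const_mul 2)).add
      ((hHd (x - h)).comp_sub_const x h)).div_const _
  have hWlip : ∀ x y, 0 ≤ x → x ≤ y → y ≤ 1 → |W y - W x| ≤ M * (y - x) := by
    intro x y h0 hxy h1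
    have e : W y - W x = ∫ s in x..y, (F (s - h) - 2 * F s + F (s + h)) := by
      rw [integral_add ((hFsub h x y).sub ((hF x y).const_mul 2)) (hFadd h x y),
        integral_sub (hFsub h x y) ((hF x y).const_mul 2), intervalIntegral.integral_const_mul,
        integral_comp_sub_right (fun s => F s), integral_comp_add_right (fun s => F s),
        ← hGsub, ← hGsub, ← hGsub]
      simp only [hW]; ring
    rw [e]
    have := norm_integral_le_of_norm_le_const (a := x) (b := y) (C := M)
      (f := fun s => F (s - h) - 2 * F s + F (s + h)) (fun s hs => by
        rw [uIoc_of_le hxy] at hs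
        exact hM s ⟨by linarith [hs.1], by linarith [hs.2]⟩ h ⟨hh.le, le_rfl⟩)
    rwa [abs_of_nonneg (sub_nonneg.2 hxy)] at this
  have hconv : ∀ e : ℝ, |e| = 1 →
      ConvexOn ℝ (Set.Icc 0 1) (fun x => M / (2 * h ^ 2) * x ^ 2 + e * Z x) := by
    intro e he
    have hd : ∀ x, HasDerivAt (fun x => M / (2 * h ^ 2) * x ^ 2 + e * Z x)
        (M / (2 * h ^ 2) * (2 * x) + e * (W x / h ^ 2)) x := fun x => by
      have := ((hasDerivAt_pow 2 x).const_mul (M / (2 * h ^ 2))).add ((hZd x).const_mul e)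
      exact this.congr_deriv (by simp)
    apply MonotoneOn.convexOn_of_deriv (convex_Icc 0 1)
    · exact fun x _ => (hd x).continuousAt.continuousWithinAt
    · exact fun x _ => (hd x).differentiableAt.differentiableWithinAt
    · intro x hx y hy hxy
      rw [interior_Icc] at hx hy
      rw [(hd x).deriv, (hd y).deriv]
      have h1 := hWlip x y hx.1.le hxy hy.2.le
      have h2 : -(M * (y - x)) ≤ e * (W y - W x) := by
        have : |e * (W y - W x)| ≤ M * (y - x) := by rw [abs_mul, he, one_mul]; exact h1
        exact (abs_le.1 this).1
      have : 0 ≤ (M * (y - x) + e * (W y - W x)) / h ^ 2 := by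
        apply div_nonneg _ (by positivity); linarith
      have e2 : (M * (y - x) + e * (W y - W x)) / h ^ 2 =
        (M / (2 * h ^ 2) * (2 * y) + e * (W y / h ^ 2)) -
          (M / (2 * h ^ 2) * (2 * x) + e * (W x / h ^ 2)) := by field_simp; ring
      linarith
  refine ⟨Z, fun x hx => ?_, by simpa using hconv 1 (by simp), by
    simpa [sub_eq_add_neg] using hconv (-1) (by simp)⟩
  have hψd : ∀ t, HasDerivAt (fun t => H (x + t) - 2 * H x + H (x - t) - t ^ 2 * F x)
      (G (x + t) - G (x - t) - 2 * t * F x) t := fun t => by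
    have := ((((hHd (x + t)).comp_const_add x t).sub_const (2 * H x)).add
      ((hHd (x - t)).comp_const_sub x t)).sub ((hasDerivAt_pow 2 t).mul_const (F x))
    exact this.congr_deriv (by simp; ring)
  have hb : ∀ t ∈ Set.Icc 0 h, |G (x + t) - G (x - t) - 2 * t * F x| ≤ M * t := by
    intro t ht
    have e : G (x + t) - G (x - t) - 2 * t * F x =
        ∫ s in (0 : ℝ)..t, (F (x - s) - 2 * F x + F (x + s)) := by
      rw [integral_add ((hFsub' x 0 t).sub (by simp)) (hFadd' x 0 t),
        integral_sub (hFsub' x 0 t) (by simp), intervalIntegral.integral_const,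
        integral_comp_sub_left (fun s => F s), integral_comp_add_left (fun s => F s),
        ← hGsub, ← hGsub]
      simp; ring
    rw [e]
    have := norm_integral_le_of_norm_le_const (a := 0) (b := t) (C := M)
      (f := fun s => F (x - s) - 2 * F x + F (x + s)) (fun s hs => by
        rw [uIoc_of_le ht.1] at hs
        exact hM x hx s ⟨hs.1.le, hs.2.trans ht.2⟩)
    rwa [sub_zero, abs_of_nonneg ht.1] at this
  have key := image_norm_le_of_norm_deriv_right_le_deriv_boundary (a := 0) (b := h)
    (f := fun t => H (x + t) - 2 * H x + H (x - t) - t ^ 2 * F x)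
    (f' := fun t => G (x + t) - G (x - t) - 2 * t * F x)
    (B := fun t => M / 2 * t ^ 2) (B' := fun t => M * t)
    (fun t _ => (hψd t).continuousAt.continuousWithinAt)
    (fun t _ => (hψd t).hasDerivWithinAt) (by simp; ring_nf)
    (fun t => by
      have := (hasDerivAt_pow 2 t).const_mul (M / 2)
      exact this.congr_deriv (by simp; ring))
    (fun t ht => hb t ⟨ht.1, ht.2.le⟩) (x := h) ⟨hh.le, le_rfl⟩
  have e : F x - Z x = -((H (x + h) - 2 * H x + H (x - h) - h ^ 2 * F x) / h ^ 2) := by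
    simp only [hZ]; field_simp; ring
  rw [e, abs_neg, abs_div, abs_of_pos (by positivity : 0 < h ^ 2), div_le_iff₀ (by positivity)]
  simpa using key

theorem exists_convex_approx {f : ℝ → ℝ} (hf : Continuous f) {h ω : ℝ} (hh : 0 < h)
    (hh2 : h ≤ 1 / 2)
    (hω : ∀ x t, 0 ≤ x - |t| → x + |t| ≤ 1 → |t| ≤ h →
      |f (x - t) - 2 * f x + f (x + t)| ≤ ω) :
    ∃ g : ℝ → ℝ, (∀ x ∈ Set.Icc (0 : ℝ) 1, |f x - g x| ≤ 3 / 4 * ω) ∧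
      ConvexOn ℝ (Set.Icc 0 1) (fun x => 3 / 4 * ω / h ^ 2 * x ^ 2 + g x) ∧
      ConvexOn ℝ (Set.Icc 0 1) (fun x => 3 / 4 * ω / h ^ 2 * x ^ 2 - g x) := by
  obtain ⟨p, q, hpq⟩ := exists_affine_abs_sub_le hf (a := 0) (b := 2 * h) (ω := ω) (by linarith)
    (fun x t h1 h2 => hω x t h1 (by linarith) (by linarith))
  obtain ⟨p', q', hpq'⟩ := exists_affine_abs_sub_le hf (a := 1 - 2 * h) (b := 1) (ω := ω)
    (by linarith) (fun x t h1 h2 => hω x t (by linarith) (by linarith) (by linarith))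
  have hω0 : 0 ≤ ω := (abs_nonneg _).trans (hω 0 0 (by simp) (by simp) (by simpa using hh.le))
  set F : ℝ → ℝ := fun x => if x < 0 then p * x + q else if x ≤ 1 then f x else p' * x + q' with hF
  have hFi : ∀ a b, IntervalIntegrable F volume a b := fun a b =>
    intervalIntegrable_ite_ite (by fun_prop) hf (by fun_prop) 0 1 a b
  have hF0 : ∀ x, x < 0 → F x = p * x + q := fun x hx => by simp [hF, hx]
  have hF1 : ∀ x, 1 < x → F x = p' * x + q' := fun x hx => by
    simp [hF, not_lt.2 (zero_le_one.trans hx.le), not_le.2 hx]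
  have hFf : ∀ x, 0 ≤ x → x ≤ 1 → F x = f x := fun x h0 h1 => by simp [hF, not_lt.2 h0, h1]
  obtain ⟨g, hg1, hg2, hg3⟩ := exists_steklov_mean hFi (M := 3 / 2 * ω) hh (fun x hx t ht => by
    rw [hFf x hx.1 hx.2]
    rcases lt_or_ge (x - t) 0 with h1 | h1
    · rw [hF0 _ h1, hFf (x + t) (by linarith [hx.1, ht.1]) (by linarith [ht.2])]
      have a1 := abs_le.1 (hpq x ⟨hx.1, by linarith [ht.2]⟩)
      have a2 := abs_le.1 (hpq (x + t) ⟨by linarith [hx.1, ht.1], by linarith [ht.2]⟩)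
      rw [abs_le]; constructor <;> linarith
    rcases lt_or_ge 1 (x + t) with h2 | h2
    · rw [hF1 _ h2, hFf (x - t) h1 (by linarith [hx.2, ht.1])]
      have a1 := abs_le.1 (hpq' x ⟨by linarith [ht.2], hx.2⟩)
      have a2 := abs_le.1 (hpq' (x - t) ⟨by linarith [ht.2], by linarith [hx.2, ht.1]⟩)
      rw [abs_le]; constructor <;> linarith
    · rw [hFf _ h1 (by linarith [hx.2, ht.1]), hFf _ (by linarith [hx.1, ht.1]) h2]
      have hab := abs_of_nonneg ht.1
      have := hω x t (by rwa [hab]) (by rwa [hab]) (by rw [hab]; exact ht.2)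
      linarith)
  have e : 3 / 2 * ω / (2 * h ^ 2) = 3 / 4 * ω / h ^ 2 := by field_simp; ring
  rw [e] at hg2 hg3
  refine ⟨g, fun x hx => ?_, hg2, hg3⟩
  have := hg1 x hx
  rw [hFf x hx.1 hx.2] at this
  linarith

theorem bernsteinPiece_eq {m : ℕ} (hm : 0 < m) (n k : ℕ) (f : ℝ → ℝ) (x : ℝ) :
    bernsteinPiece n m k f x = ∑ i ∈ Finset.range (n + 1),
      (bernsteinPolynomial ℝ n i).eval (m * x - (k - 1)) *
        f (((k : ℝ) * n - n + i) / ((m : ℝ) * n)) := by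
  have hm' : (m : ℝ) ≠ 0 := by positivity
  rw [bernsteinPiece, Finset.mul_sum]
  refine Finset.sum_congr rfl fun i hi => ?_
  have hi' : i ≤ n := by simpa [Nat.lt_succ_iff] using hi
  have e1 : (m : ℝ) * x - (k - 1) = m * (x - ((k : ℝ) - 1) / m) := by field_simp
  have e2 : 1 - ((m : ℝ) * x - (k - 1)) = m * ((k : ℝ) / m - x) := by field_simp; ring
  have e3 : (m : ℝ) ^ n = m ^ i * m ^ (n - i) := by rw [← pow_add, Nat.add_sub_cancel' hi']
  simp only [bernsteinPolynomial, Polynomial.eval_mul, Polynomial.eval_pow, Polynomial.eval_X,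
    Polynomial.eval_sub, Polynomial.eval_one, Polynomial.eval_natCast]
  rw [e2, e1, mul_pow, mul_pow, e3]
  ring

theorem bernsteinPiece_node_mem {n m : ℕ} (hn : 0 < n) (hm : 0 < m) (k : ℕ) {i : ℕ} (hi : i ≤ n) :
    ((k : ℝ) * n - n + i) / ((m : ℝ) * n) ∈ Set.Icc (((k : ℝ) - 1) / m) ((k : ℝ) / m) := by
  have hn' : (0 : ℝ) < n := by positivity
  have hm' : (0 : ℝ) < m := by positivity
  have hi' : (i : ℝ) ≤ n := by exact_mod_cast hi
  constructor
  · rw [div_le_div_iff₀ hm' (by positivity)]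
    have : (0 : ℝ) ≤ m * i := by positivity
    linarith
  · rw [div_le_div_iff₀ (by positivity) hm']
    have : (m : ℝ) * i ≤ m * n := by gcongr
    linarith

theorem bernsteinPiece_mono {n m : ℕ} (hn : 0 < n) (hm : 0 < m) (k : ℕ) {f g : ℝ → ℝ}
    (hfg : ∀ y ∈ Set.Icc (((k : ℝ) - 1) / m) ((k : ℝ) / m), f y ≤ g y) {x : ℝ}
    (hx : x ∈ Set.Icc (((k : ℝ) - 1) / m) ((k : ℝ) / m)) :
    bernsteinPiece n m k f x ≤ bernsteinPiece n m k g x := by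
  have h1 := sub_nonneg.2 hx.1
  have h2 := sub_nonneg.2 hx.2
  unfold bernsteinPiece
  gcongr with i hi
  exact hfg _ (bernsteinPiece_node_mem hn hm k (by simpa [Nat.lt_succ_iff] using hi))

theorem bernsteinPiece_congr {n m : ℕ} (hn : 0 < n) (hm : 0 < m) (k : ℕ) {f g : ℝ → ℝ}
    (hfg : ∀ y ∈ Set.Icc (((k : ℝ) - 1) / m) ((k : ℝ) / m), f y = g y) {x : ℝ}
    (hx : x ∈ Set.Icc (((k : ℝ) - 1) / m) ((k : ℝ) / m)) :
    bernsteinPiece n m k f x = bernsteinPiece n m k g x :=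
  le_antisymm (bernsteinPiece_mono hn hm k (fun y hy => (hfg y hy).le) hx)
    (bernsteinPiece_mono hn hm k (fun y hy => (hfg y hy).ge) hx)

theorem bernsteinPiece_sub (n m k : ℕ) (f g : ℝ → ℝ) (x : ℝ) :
    bernsteinPiece n m k (fun y => f y - g y) x =
      bernsteinPiece n m k f x - bernsteinPiece n m k g x := by
  simp only [bernsteinPiece, mul_sub, Finset.sum_sub_distrib]

theorem bernsteinPiece_const_mul (n m k : ℕ) (c : ℝ) (f : ℝ → ℝ) (x : ℝ) :
    bernsteinPiece n m k (fun y => c * f y) x = c * bernsteinPiece n m k f x := by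
  simp only [bernsteinPiece, Finset.mul_sum]
  refine Finset.sum_congr rfl fun i _ => ?_
  ring

theorem sum_eval_bernsteinPolynomial (n : ℕ) (t : ℝ) :
    ∑ i ∈ Finset.range (n + 1), (bernsteinPolynomial ℝ n i).eval t = 1 := by
  rw [← Polynomial.eval_finsetSum, bernsteinPolynomial.sum, Polynomial.eval_one]

theorem sum_eval_bernsteinPolynomial_mul (n : ℕ) (t : ℝ) :
    ∑ i ∈ Finset.range (n + 1), (bernsteinPolynomial ℝ n i).eval t * i = n * t := by
  have := congrArg (Polynomial.eval t) (bernsteinPolynomial.sum_smul ℝ n)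
  simpa [Polynomial.eval_finsetSum, mul_comm] using this

theorem sum_eval_bernsteinPolynomial_mul_sq (n : ℕ) (t : ℝ) :
    ∑ i ∈ Finset.range (n + 1), (bernsteinPolynomial ℝ n i).eval t * (i : ℝ) ^ 2 =
      n * t * (1 - t) + (n * t) ^ 2 := by
  have h := congrArg (Polynomial.eval t) (bernsteinPolynomial.variance ℝ n)
  simp [Polynomial.eval_finsetSum] at h
  have e : ∑ i ∈ Finset.range (n + 1), ((n : ℝ) * t - i) ^ 2 * (bernsteinPolynomial ℝ n i).eval t
      = (n * t) ^ 2 * ∑ i ∈ Finset.range (n + 1), (bernsteinPolynomial ℝ n i).eval t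
        - 2 * (n * t) * ∑ i ∈ Finset.range (n + 1), (bernsteinPolynomial ℝ n i).eval t * i
        + ∑ i ∈ Finset.range (n + 1), (bernsteinPolynomial ℝ n i).eval t * (i : ℝ) ^ 2 := by
    rw [Finset.mul_sum, Finset.mul_sum, ← Finset.sum_sub_distrib, ← Finset.sum_add_distrib]
    refine Finset.sum_congr rfl fun i _ => ?_
    ring
  rw [h, sum_eval_bernsteinPolynomial, sum_eval_bernsteinPolynomial_mul] at e
  linarith

theorem bernsteinPiece_affine {n m : ℕ} (hn : 0 < n) (hm : 0 < m) (k : ℕ) (p q x : ℝ) :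
    bernsteinPiece n m k (fun y => p * y + q) x = p * x + q := by
  have hn' : (n : ℝ) ≠ 0 := by positivity
  have hm' : (m : ℝ) ≠ 0 := by positivity
  rw [bernsteinPiece_eq hm]
  set t : ℝ := m * x - (k - 1) with ht
  have e : ∑ i ∈ Finset.range (n + 1), (bernsteinPolynomial ℝ n i).eval t *
      (p * (((k : ℝ) * n - n + i) / ((m : ℝ) * n)) + q) =
      (p * (k - 1) / m + q) * ∑ i ∈ Finset.range (n + 1), (bernsteinPolynomial ℝ n i).eval t
      + p / (m * n) * ∑ i ∈ Finset.range (n + 1), (bernsteinPolynomial ℝ n i).eval t * i := by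
    rw [Finset.mul_sum, Finset.mul_sum, ← Finset.sum_add_distrib]
    refine Finset.sum_congr rfl fun i _ => ?_
    field_simp; ring
  rw [e, sum_eval_bernsteinPolynomial, sum_eval_bernsteinPolynomial_mul, ht]
  field_simp; ring

theorem bernsteinPiece_quadratic {n m : ℕ} (hn : 0 < n) (hm : 0 < m) (k : ℕ) (x : ℝ) :
    bernsteinPiece n m k (fun y => (y - ((k : ℝ) - 1) / m) * ((k : ℝ) / m - y)) x =
      (1 - 1 / n) * ((x - ((k : ℝ) - 1) / m) * ((k : ℝ) / m - x)) := by
  have hn' : (n : ℝ) ≠ 0 := by positivity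
  have hm' : (m : ℝ) ≠ 0 := by positivity
  rw [bernsteinPiece_eq hm]
  set t : ℝ := m * x - (k - 1) with ht
  have e : ∑ i ∈ Finset.range (n + 1), (bernsteinPolynomial ℝ n i).eval t *
      ((((k : ℝ) * n - n + i) / ((m : ℝ) * n) - ((k : ℝ) - 1) / m) *
        ((k : ℝ) / m - ((k : ℝ) * n - n + i) / ((m : ℝ) * n))) =
      1 / (m ^ 2 * n) * ∑ i ∈ Finset.range (n + 1), (bernsteinPolynomial ℝ n i).eval t * i
      - 1 / (m * n) ^ 2 *
        ∑ i ∈ Finset.range (n + 1), (bernsteinPolynomial ℝ n i).eval t * (i : ℝ) ^ 2 := by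
    rw [Finset.mul_sum, Finset.mul_sum, ← Finset.sum_sub_distrib]
    refine Finset.sum_congr rfl fun i _ => ?_
    field_simp; ring
  rw [e, sum_eval_bernsteinPolynomial_mul, sum_eval_bernsteinPolynomial_mul_sq, ht]
  field_simp; ring

theorem bernsteinPiece_left {n m : ℕ} (hn : 0 < n) (hm : 0 < m) (k : ℕ) (f : ℝ → ℝ) :
    bernsteinPiece n m k f (((k : ℝ) - 1) / m) = f (((k : ℝ) - 1) / m) := by
  have hn' : (n : ℝ) ≠ 0 := by positivity
  have hm' : (m : ℝ) ≠ 0 := by positivity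
  rw [bernsteinPiece_eq hm, Finset.sum_eq_single 0]
  · have : (m : ℝ) * (((k : ℝ) - 1) / m) - (k - 1) = 0 := by field_simp; ring
    rw [this, bernsteinPolynomial.eval_at_0]
    simp only [if_true, one_mul]
    congr 1
    simp only [Nat.cast_zero]; field_simp; ring
  · intro i _ hi
    have : (m : ℝ) * (((k : ℝ) - 1) / m) - (k - 1) = 0 := by field_simp; ring
    rw [this, bernsteinPolynomial.eval_at_0]
    simp [hi]
  · simp

theorem bernsteinPiece_right {n m : ℕ} (hn : 0 < n) (hm : 0 < m) (k : ℕ) (f : ℝ → ℝ) :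
    bernsteinPiece n m k f ((k : ℝ) / m) = f ((k : ℝ) / m) := by
  have hn' : (n : ℝ) ≠ 0 := by positivity
  have hm' : (m : ℝ) ≠ 0 := by positivity
  have e : (m : ℝ) * ((k : ℝ) / m) - (k - 1) = 1 := by field_simp; ring
  rw [bernsteinPiece_eq hm, Finset.sum_eq_single n]
  · rw [e, bernsteinPolynomial.eval_at_1]
    simp only [if_true, one_mul]
    congr 1
    field_simp; ring
  · intro i _ hi
    rw [e, bernsteinPolynomial.eval_at_1]
    simp [hi]
  · simp

theorem pieceIdx_eq_or_eq_right {m : ℕ} (hm : 0 < m) {k : ℕ} (hk1 : 1 ≤ k) (hk2 : k ≤ m) {x : ℝ}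
    (hx : x ∈ Set.Icc (((k : ℝ) - 1) / m) ((k : ℝ) / m)) :
    pieceIdx m x = k ∨ x = (k : ℝ) / m ∧ pieceIdx m x = k + 1 := by
  have hm' : (0 : ℝ) < m := by positivity
  have h1 : (k : ℝ) - 1 ≤ m * x := by have := (div_le_iff₀' hm').1 hx.1; exact this
  have h2 : m * x ≤ (k : ℝ) := by have := (le_div_iff₀' hm').1 hx.2; exact this
  rcases h2.eq_or_lt with h | h
  · have hfl : ⌊(m : ℝ) * x⌋ = (k : ℤ) := by rw [h]; exact Int.floor_natCast k
    have hxe : x = (k : ℝ) / m := by rw [← h]; field_simp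
    rw [pieceIdx, hfl]
    simp only [Int.toNat_natCast]
    rcases hk2.eq_or_lt with h' | h'
    · left; omega
    · right; exact ⟨hxe, by omega⟩
  · have hfl : ⌊(m : ℝ) * x⌋ = (k : ℤ) - 1 := by
      rw [Int.floor_eq_iff]; push_cast
      exact ⟨h1, by linarith⟩
    left
    rw [pieceIdx, hfl]
    omega

theorem compBernstein_eq_bernsteinPiece {n m : ℕ} (hn : 0 < n) (hm : 0 < m) {k : ℕ} (hk1 : 1 ≤ k)
    (hk2 : k ≤ m) (f : ℝ → ℝ) {x : ℝ}
    (hx : x ∈ Set.Icc (((k : ℝ) - 1) / m) ((k : ℝ) / m)) :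
    compBernstein n m f x = bernsteinPiece n m k f x := by
  rcases pieceIdx_eq_or_eq_right hm hk1 hk2 hx with h | ⟨h, h'⟩
  · rw [compBernstein, h]
  · rw [compBernstein, h', h, bernsteinPiece_right hn hm]
    have := bernsteinPiece_left hn hm (k + 1) f
    push_cast at this
    rwa [add_sub_cancel_right] at this

theorem compBernstein_iterate_eq {n m : ℕ} (hn : 0 < n) (hm : 0 < m) {k : ℕ} (hk1 : 1 ≤ k)
    (hk2 : k ≤ m) (f : ℝ → ℝ) (r : ℕ) {x : ℝ}
    (hx : x ∈ Set.Icc (((k : ℝ) - 1) / m) ((k : ℝ) / m)) :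
    (compBernstein n m)^[r] f x = (bernsteinPiece n m k)^[r] f x := by
  induction r generalizing x with
  | zero => rfl
  | succ r ih =>
    rw [Function.iterate_succ_apply', Function.iterate_succ_apply',
      compBernstein_eq_bernsteinPiece hn hm hk1 hk2 _ hx]
    exact bernsteinPiece_congr hn hm k (fun y hy => ih hy) hx

theorem pwLinear_eq {m : ℕ} (hm : 0 < m) {k : ℕ} (hk1 : 1 ≤ k)
    (hk2 : k ≤ m) (f : ℝ → ℝ) {x : ℝ}
    (hx : x ∈ Set.Icc (((k : ℝ) - 1) / m) ((k : ℝ) / m)) :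
    pwLinear m f x = m * (((k : ℝ) / m - x) * f (((k : ℝ) - 1) / m) +
      (x - ((k : ℝ) - 1) / m) * f ((k : ℝ) / m)) := by
  have hm' : (m : ℝ) ≠ 0 := by positivity
  rcases pieceIdx_eq_or_eq_right hm hk1 hk2 hx with h | ⟨h, h'⟩
  · rw [pwLinear, h]
  · rw [pwLinear, h', h]
    push_cast
    rw [add_sub_cancel_right]
    field_simp; ring

theorem bernsteinPiece_iterate_mono {n m : ℕ} (hn : 0 < n) (hm : 0 < m) (k r : ℕ) {f g : ℝ → ℝ}
    (hfg : ∀ y ∈ Set.Icc (((k : ℝ) - 1) / m) ((k : ℝ) / m), f y ≤ g y) {x : ℝ}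
    (hx : x ∈ Set.Icc (((k : ℝ) - 1) / m) ((k : ℝ) / m)) :
    (bernsteinPiece n m k)^[r] f x ≤ (bernsteinPiece n m k)^[r] g x := by
  induction r generalizing x with
  | zero => exact hfg x hx
  | succ r ih =>
    rw [Function.iterate_succ_apply', Function.iterate_succ_apply']
    exact bernsteinPiece_mono hn hm k (fun y hy => ih hy) hx

theorem bernsteinPiece_iterate_sub (n m k r : ℕ) (f g : ℝ → ℝ) :
    (bernsteinPiece n m k)^[r] (fun y => f y - g y) =
      fun y => (bernsteinPiece n m k)^[r] f y - (bernsteinPiece n m k)^[r] g y := by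
  induction r with
  | zero => rfl
  | succ r ih =>
    simp only [Function.iterate_succ_apply', ih]
    exact funext fun x => bernsteinPiece_sub n m k _ _ x

theorem bernsteinPiece_iterate_affine {n m : ℕ} (hn : 0 < n) (hm : 0 < m) (k r : ℕ) (p q : ℝ) :
    (bernsteinPiece n m k)^[r] (fun y => p * y + q) = fun y => p * y + q :=
  Function.iterate_fixed (funext fun x => bernsteinPiece_affine hn hm k p q x) r

theorem bernsteinPiece_iterate_quadratic {n m : ℕ} (hn : 0 < n) (hm : 0 < m) (k r : ℕ) (c : ℝ) :
    (bernsteinPiece n m k)^[r] (fun y => c * ((y - ((k : ℝ) - 1) / m) * ((k : ℝ) / m - y))) =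
      fun y => c * (1 - 1 / n) ^ r * ((y - ((k : ℝ) - 1) / m) * ((k : ℝ) / m - y)) := by
  induction r with
  | zero => simp
  | succ r ih =>
    rw [Function.iterate_succ_apply', ih]
    funext x
    rw [bernsteinPiece_const_mul, bernsteinPiece_quadratic hn hm]
    ring

theorem bernsteinPiece_iterate_abs_le {n m : ℕ} (hn : 0 < n) (hm : 0 < m) (k r : ℕ) {f g : ℝ → ℝ}
    (hfg : ∀ y ∈ Set.Icc (((k : ℝ) - 1) / m) ((k : ℝ) / m), |f y| ≤ g y) {x : ℝ}
    (hx : x ∈ Set.Icc (((k : ℝ) - 1) / m) ((k : ℝ) / m)) :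
    |(bernsteinPiece n m k)^[r] f x| ≤ (bernsteinPiece n m k)^[r] g x := by
  have h0 : (bernsteinPiece n m k)^[r] (fun _ => (0 : ℝ)) = fun _ => 0 := by
    simpa using bernsteinPiece_iterate_affine hn hm k r 0 0
  have h1 := bernsteinPiece_iterate_mono hn hm k r (fun y hy => (abs_le.1 (hfg y hy)).2) hx
  have h2 := bernsteinPiece_iterate_mono hn hm k r (f := fun y => 0 - g y) (g := f)
    (fun y hy => by linarith [(abs_le.1 (hfg y hy)).1]) hx
  rw [bernsteinPiece_iterate_sub, h0] at h2
  rw [abs_le]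
  constructor <;> linarith

theorem bernsteinPiece_iterate_left {n m : ℕ} (hn : 0 < n) (hm : 0 < m) (k r : ℕ) (f : ℝ → ℝ) :
    (bernsteinPiece n m k)^[r] f (((k : ℝ) - 1) / m) = f (((k : ℝ) - 1) / m) := by
  induction r with
  | zero => rfl
  | succ r ih => rw [Function.iterate_succ_apply', bernsteinPiece_left hn hm, ih]

theorem bernsteinPiece_iterate_right {n m : ℕ} (hn : 0 < n) (hm : 0 < m) (k r : ℕ) (f : ℝ → ℝ) :
    (bernsteinPiece n m k)^[r] f ((k : ℝ) / m) = f ((k : ℝ) / m) := by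
  induction r with
  | zero => rfl
  | succ r ih => rw [Function.iterate_succ_apply', bernsteinPiece_right hn hm, ih]

theorem bernsteinPiece_one (m k : ℕ) (f : ℝ → ℝ) (x : ℝ) :
    bernsteinPiece 1 m k f x = m * (((k : ℝ) / m - x) * f (((k : ℝ) - 1) / m) +
      (x - ((k : ℝ) - 1) / m) * f ((k : ℝ) / m)) := by
  simp [bernsteinPiece, Finset.sum_range_succ]

theorem le_omega2 {f : ℝ → ℝ} (hf : ContinuousOn f (Set.Icc 0 1)) {δ x t : ℝ}
    (h1 : 0 ≤ x - |t|) (h2 : x + |t| ≤ 1) (ht : |t| ≤ δ) :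
    |f (x - t) - 2 * f x + f (x + t)| ≤ omega2 0 1 f δ := by
  obtain ⟨C, hC⟩ := isCompact_Icc.exists_bound_of_continuousOn hf
  simp only [Real.norm_eq_abs] at hC
  apply le_csSup
  · refine ⟨4 * C, ?_⟩
    rintro v ⟨y, s, ⟨hs1, hs2⟩, ⟨hs3, hs4⟩, -, rfl⟩
    have a1 := abs_le.1 (hC (y - s) ⟨hs1, hs2⟩)
    have a2 := abs_le.1 (hC y ⟨by linarith, by linarith⟩)
    have a3 := abs_le.1 (hC (y + s) ⟨hs3, hs4⟩)
    rw [abs_le]; constructor <;> linarith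
  · have := abs_le.1 (le_refl |t|)
    exact ⟨x, t, ⟨by linarith, by linarith⟩, ⟨by linarith, by linarith⟩, ht, rfl⟩

theorem abs_chord_sub_le_of_convexOn {g : ℝ → ℝ} {a b c y : ℝ} (hab : a < b)
    (h1 : ConvexOn ℝ (Set.Icc 0 1) (fun x => c * x ^ 2 + g x))
    (h2 : ConvexOn ℝ (Set.Icc 0 1) (fun x => c * x ^ 2 - g x))
    (ha : 0 ≤ a) (hb : b ≤ 1) (hy : y ∈ Set.Icc a b) :
    |((b - y) * g a + (y - a) * g b) / (b - a) - g y| ≤ c * ((y - a) * (b - y)) := by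
  have hba : 0 < b - a := sub_pos.2 hab
  have key : ∀ φ : ℝ → ℝ, ConvexOn ℝ (Set.Icc 0 1) φ →
      φ y * (b - a) ≤ (b - y) * φ a + (y - a) * φ b := by
    intro φ hφ
    have ha' : a ∈ Set.Icc (0 : ℝ) 1 := ⟨ha, by linarith⟩
    have hb' : b ∈ Set.Icc (0 : ℝ) 1 := ⟨by linarith, hb⟩
    have := hφ.2 ha' hb'
      (div_nonneg (sub_nonneg.2 hy.2) hba.le) (div_nonneg (sub_nonneg.2 hy.1) hba.le)
      (by field_simp; ring)
    have e : (b - y) / (b - a) * a + (y - a) / (b - a) * b = y := by field_simp; ring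
    simp only [smul_eq_mul, e] at this
    calc φ y * (b - a) ≤ _ := mul_le_mul_of_nonneg_right this hba.le
      _ = _ := by field_simp
  have k1 := key _ h1
  have k2 := key _ h2
  have e : ((b - y) * g a + (y - a) * g b) / (b - a) - g y =
    ((b - y) * g a + (y - a) * g b - g y * (b - a)) / (b - a) := by field_simp
  rw [e, abs_div, abs_of_pos hba, div_le_iff₀ hba, abs_le]
  constructor <;> linarith

theorem compBernstein_iterates
    (n m r : ℕ) (hn : 0 < n) (hm : 0 < m) (hr : 0 < r)
    (k : ℕ) (hk1 : 1 ≤ k) (hk2 : k ≤ m)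
    (f : ℝ → ℝ) (hf : ContinuousOn f (Set.Icc 0 1))
    (x : ℝ) (hx : x ∈ Set.Icc (((k : ℝ) - 1) / (m : ℝ)) ((k : ℝ) / (m : ℝ))) :
    |(compBernstein n m)^[r] f x - pwLinear m f x| ≤
      9 / 4 * omega2 0 1 f
        (Real.sqrt ((x - ((k : ℝ) - 1) / (m : ℝ)) * ((k : ℝ) / (m : ℝ) - x) *
          (1 - 1 / (n : ℝ)) ^ r)) := by
  have hn' : (1 : ℝ) ≤ n := by exact_mod_cast hn
  have hm' : (1 : ℝ) ≤ m := by exact_mod_cast hm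
  have hm0 : (m : ℝ) ≠ 0 := by positivity
  have hk1' : (1 : ℝ) ≤ k := by exact_mod_cast hk1
  have hk2' : (k : ℝ) ≤ m := by exact_mod_cast hk2
  rw [compBernstein_iterate_eq hn hm hk1 hk2 f r hx, pwLinear_eq hm hk1 hk2 f hx]
  set a : ℝ := ((k : ℝ) - 1) / m with ha
  set b : ℝ := (k : ℝ) / m with hb
  set T := bernsteinPiece n m k with hT
  have hba : b - a = 1 / m := by rw [ha, hb]; field_simp; ring
  have hab : a < b := by have : (0 : ℝ) < 1 / m := by positivity
                         linarith
  have ha0 : 0 ≤ a := div_nonneg (by linarith) (by linarith)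
  have hb1 : b ≤ 1 := (div_le_one (by linarith)).2 hk2'
  have hL : ∀ (φ : ℝ → ℝ) (y : ℝ), (m : ℝ) * ((b - y) * φ a + (y - a) * φ b) =
      ((b - y) * φ a + (y - a) * φ b) / (b - a) := fun φ y => by
    rw [hba]; field_simp
  have hTL : ∀ (s : ℕ) (φ : ℝ → ℝ), T^[s] (fun y => (m : ℝ) * ((b - y) * φ a + (y - a) * φ b)) =
      fun y => (m : ℝ) * ((b - y) * φ a + (y - a) * φ b) := fun s φ => by
    have := bernsteinPiece_iterate_affine hn hm k s (m * (φ b - φ a)) (m * (b * φ a - a * φ b))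
    convert this using 2
    · ext y; ring
    · ring
  set ρ : ℝ := (1 - 1 / (n : ℝ)) ^ r with hρ
  have hρ' : 0 ≤ 1 - 1 / (n : ℝ) := by
    rw [sub_nonneg, div_le_one (by linarith)]; exact hn'
  have hρ0 : 0 ≤ ρ := pow_nonneg hρ' r
  have hρ1 : ρ ≤ 1 := pow_le_one₀ hρ' (by
    have : 0 ≤ 1 / (n : ℝ) := by positivity
    linarith)
  have hxa := sub_nonneg.2 hx.1
  have hxb := sub_nonneg.2 hx.2
  have hw : (x - a) * (b - x) ≤ 1 / 4 := by
    nlinarith [sq_nonneg ((x - a) - (b - x))]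
  set h : ℝ := Real.sqrt ((x - a) * (b - x) * ρ) with hh
  have hsq : h ^ 2 = (x - a) * (b - x) * ρ := Real.sq_sqrt (by positivity)
  have hω : ∀ y t, 0 ≤ y - |t| → y + |t| ≤ 1 → |t| ≤ h →
      |f (y - t) - 2 * f y + f (y + t)| ≤ omega2 0 1 f h := fun y t => le_omega2 hf
  have hω0 : 0 ≤ omega2 0 1 f h :=
    (abs_nonneg _).trans (hω 0 0 (by simp) (by simp) (by simp [hh]))
  set ω := omega2 0 1 f h
  rcases (Real.sqrt_nonneg _ : 0 ≤ h).eq_or_lt with h0 | h0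
  · suffices hs : T^[r] f x = m * ((b - x) * f a + (x - a) * f b) by
      rw [hs, sub_self, abs_zero]; positivity
    have hz : (x - a) * (b - x) * ρ = 0 := by rw [← hsq, show h = 0 from h0.symm]; norm_num
    have hmba : (m : ℝ) * (b - a) = 1 := by rw [hba]; field_simp
    rcases mul_eq_zero.1 hz with hz | hz
    · rcases mul_eq_zero.1 hz with hz | hz
      · obtain rfl : x = a := by linarith
        rw [bernsteinPiece_iterate_left hn hm]
        linear_combination -f a * hmba
      · obtain rfl : x = b := by linarith
        rw [bernsteinPiece_iterate_right hn hm]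
        linear_combination -f b * hmba
    · have h1n : 1 / (n : ℝ) = 1 := by linarith [eq_zero_of_pow_eq_zero hz]
      obtain rfl : n = 1 := by
        rw [div_eq_iff (by positivity), one_mul] at h1n
        exact_mod_cast h1n.symm
      obtain ⟨r, rfl⟩ := Nat.exists_eq_add_of_lt hr
      have hTf : T f = fun y => (m : ℝ) * ((b - y) * f a + (y - a) * f b) :=
        funext (bernsteinPiece_one m k f)
      rw [Function.iterate_succ_apply, hTf, hTL]
  · have hh2 : h ≤ 1 / 2 := by
      apply le_of_sq_le_sq _ (by norm_num)
      rw [hsq]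
      nlinarith [mul_nonneg hxa hxb]
    set f' : ℝ → ℝ := Set.IccExtend (zero_le_one' ℝ) ((Set.Icc 0 1).domRestrict f) with hf'
    have hfc : Continuous f' := (continuousOn_iff_continuous_domRestrict.1 hf).Icc_extend'
    have hff : ∀ y, 0 ≤ y → y ≤ 1 → f' y = f y := fun y h1 h2 => by
      rw [hf', Set.IccExtend_of_mem _ _ ⟨h1, h2⟩]; rfl
    obtain ⟨g, hg1, hg2, hg3⟩ := exists_convex_approx hfc h0 hh2 (ω := ω) (fun y t h1 h2 h3 => by
      have h4 := abs_le.1 (le_refl |t|)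
      rw [hff _ (by linarith) (by linarith), hff _ (by linarith) (by linarith),
        hff _ (by linarith) (by linarith)]
      exact hω y t h1 h2 h3)
    have hfg : ∀ y, y ∈ Set.Icc a b → |f y - g y| ≤ 3 / 4 * ω := fun y hy => by
      have hy0 := ha0.trans hy.1
      have hy1 := hy.2.trans hb1
      rw [← hff y hy0 hy1]
      exact hg1 y ⟨hy0, hy1⟩
    have s1 : |T^[r] f x - T^[r] g x| ≤ 3 / 4 * ω := by
      have := bernsteinPiece_iterate_abs_le hn hm k r (f := fun y => f y - g y)
        (g := fun y => 0 * y + 3 / 4 * ω) (fun y hy => by simpa using hfg y hy) hx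
      rw [bernsteinPiece_iterate_sub, bernsteinPiece_iterate_affine hn hm] at this
      simpa using this
    have s2 : |m * ((b - x) * g a + (x - a) * g b) - T^[r] g x| ≤ 3 / 4 * ω := by
      have := bernsteinPiece_iterate_abs_le hn hm k r
        (f := fun y => m * ((b - y) * g a + (y - a) * g b) - g y)
        (g := fun y => 3 / 4 * ω / h ^ 2 * ((y - a) * (b - y)))
        (fun y hy => by
          rw [hL]; exact abs_chord_sub_le_of_convexOn hab hg2 hg3 ha0 hb1 hy) hx
      rw [bernsteinPiece_iterate_sub, bernsteinPiece_iterate_quadratic hn hm, hTL] at this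
      refine this.trans_eq ?_
      have : (x - a) * (b - x) * ρ ≠ 0 := by rw [← hsq]; positivity
      calc 3 / 4 * ω / h ^ 2 * ρ * ((x - a) * (b - x)) =
          3 / 4 * ω * (((x - a) * (b - x) * ρ) / h ^ 2) := by ring
        _ = _ := by rw [hsq, div_self this, mul_one]
    have s3 : |m * ((b - x) * f a + (x - a) * f b) - m * ((b - x) * g a + (x - a) * g b)|
        ≤ 3 / 4 * ω := by
      have a1 := abs_le.1 (hfg a ⟨le_rfl, hab.le⟩)
      have a2 := abs_le.1 (hfg b ⟨hab.le, le_rfl⟩)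
      rw [hL f, hL g, ← sub_div, abs_div, abs_of_pos (sub_pos.2 hab), div_le_iff₀ (sub_pos.2 hab),
        abs_le]
      constructor <;> nlinarith
    have := abs_le.1 s1
    have := abs_le.1 s2
    have := abs_le.1 s3
    rw [abs_le]
    constructor <;> linarith
end
end
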